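/- Let d ≥ 2, p ∈ [2,∞], and let A ∈ ℝ^{n_1×⋯×n_d} be an order-d tensor with symmetrization sym(A) ∈ ℝ^{N^d}, N = n_1+⋯+n_d. Then sup{ F_{sym(A)}(z^1,…,z^d) : z^i ∈ ℝ^N, ‖z^i‖_p ≤ d^{1/p} for i = 1,…,d } = d! · sup{ F_A(x^1,…,x^d) : x^i ∈ ℝ^{n_i}, ‖x^i‖_p ≤ 1 for i = 1,…,d }. -/

import Mathlib

open scoped ENNReal

/-- The `L_p` norm of a vector `x ∈ ℝ^ι`, for `p ∈ [1,∞]` (for `p = ∞`, the max norm). -/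
noncomputable def lpNorm {ι : Type*} [Fintype ι] (p : ℝ≥0∞) (x : ι → ℝ) : ℝ :=
  if p = ∞ then ⨆ i, |x i| else (∑ i, |x i| ^ p.toReal) ^ (1 / p.toReal)

/-- The symmetrization `sym(A)` of an order-`d` tensor `A ∈ ℝ^{n_1 × ⋯ × n_d}`. -/
noncomputable def symTensor {d : ℕ} {n : Fin d → ℕ}
    (A : ((j : Fin d) → Fin (n j)) → ℝ)
    (k : Fin d → (Σ j : Fin d, Fin (n j))) : ℝ :=
  ∑ σ : Equiv.Perm (Fin d),
    if h : ∀ t, (k (σ t)).1 = t then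
      A (fun t => Fin.cast (congrArg n (h t)) (k (σ t)).2)
    else 0

namespace Matrix

variable {ι : Type*} [Fintype ι] [DecidableEq ι]

theorem permanent_updateCol_add {R : Type*} [CommSemiring R] (M : Matrix ι ι R) (j : ι)
    (u v : ι → R) :
    permanent (updateCol M j (u + v)) =
      permanent (updateCol M j u) + permanent (updateCol M j v) := by
  simp only [permanent, ← Finset.mul_prod_erase _ _ (Finset.mem_univ j), updateCol_self,
    Pi.add_apply, add_mul, Finset.sum_add_distrib]
  congr 1 <;> refine Finset.sum_congr rfl fun p _ ↦ ?_ <;>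
    rw [Finset.prod_congr rfl fun i hi ↦ ?_] <;>
    simp only [updateCol_ne (Finset.ne_of_mem_erase hi)]

theorem permanent_updateRow_add {R : Type*} [CommSemiring R] (M : Matrix ι ι R) (j : ι)
    (u v : ι → R) :
    permanent (updateRow M j (u + v)) =
      permanent (updateRow M j u) + permanent (updateRow M j v) := by
  simp only [← permanent_transpose (updateRow M j _), ← updateCol_transpose,
    permanent_updateCol_add]

theorem permanent_updateRow_updateRow_comm {R : Type*} [CommSemiring R] (M : Matrix ι ι R)
    {a b : ι} (hab : a ≠ b) (u v : ι → R) :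
    permanent ((M.updateRow a u).updateRow b v) =
      permanent ((M.updateRow a v).updateRow b u) := by
  rw [← permanent_permute_cols (Equiv.swap a b)]
  congr 1
  ext i j
  simp only [submatrix_apply, updateRow_apply, id, Equiv.swap_apply_def]
  split_ifs <;> simp_all

theorem continuous_permanent : Continuous (permanent : Matrix ι ι ℝ → ℝ) := by
  unfold permanent
  fun_prop

theorem permanent_nonneg {M : Matrix ι ι ℝ} (hM : ∀ i j, 0 ≤ M i j) : 0 ≤ M.permanent :=
  Finset.sum_nonneg fun _ _ ↦ Finset.prod_nonneg fun _ _ ↦ hM _ _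

theorem permanent_le_permanent_abs (M : Matrix ι ι ℝ) :
    M.permanent ≤ (of fun i j ↦ |M i j|).permanent :=
  Finset.sum_le_sum fun _ _ ↦ (le_abs_self _).trans (Finset.abs_prod _ _).le

theorem permanent_of_const_rows (x : ι → ℝ) :
    (of fun _ : ι ↦ x).permanent = (Fintype.card ι).factorial * ∏ j, x j := by
  simp [permanent, Fintype.card_perm]

end Matrix

theorem prod_le_one_of_sum_sq_le_card {ι : Type*} [Fintype ι] {x : ι → ℝ}
    (hx : ∑ j, x j ^ 2 ≤ Fintype.card ι) : ∏ j, x j ≤ 1 := by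
  have h : (∏ j, x j) ^ 2 ≤ 1 := calc
    (∏ j, x j) ^ 2 = ∏ j, x j ^ 2 := (Finset.prod_pow _ _ _).symm
    _ ≤ ∏ j, Real.exp (x j ^ 2 - 1) := Finset.prod_le_prod (fun _ _ ↦ sq_nonneg _) fun j _ ↦ by
        linarith [Real.add_one_le_exp (x j ^ 2 - 1)]
    _ = Real.exp (∑ j, x j ^ 2 - Fintype.card ι) := by
        rw [← Real.exp_sum, Finset.sum_sub_distrib]; simp
    _ ≤ 1 := Real.exp_le_one_iff.2 (by linarith)
  nlinarith

/-- If a symmetric bilinear form is bounded by `C` on the ball `∑ x j ^ 2 ≤ N` and attains `C`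
at `(u, v)`, then it is large at `(u + v, u + v)`. -/
theorem le_bilin_add_of_isMax {ι : Type*} [Fintype ι] {G : (ι → ℝ) → (ι → ℝ) → ℝ}
    (hsymm : ∀ x y, G x y = G y x) (hadd : ∀ x y z, G x (y + z) = G x y + G x z)
    (hsmul : ∀ (c : ℝ) x y, G x (c • y) = c * G x y) {N C : ℝ} (hN : 0 < N)
    (hC : ∀ x y, ∑ j, x j ^ 2 ≤ N → ∑ j, y j ^ 2 ≤ N → G x y ≤ C) {u v : ι → ℝ}
    (hu : ∑ j, u j ^ 2 ≤ N) (hv : ∑ j, v j ^ 2 ≤ N) (hC0 : 0 ≤ C) (huv : C ≤ G u v) :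
    C * ∑ j, (u + v) j ^ 2 ≤ N * G (u + v) (u + v) := by
  have hlow : ∀ x, -(C * ∑ j, x j ^ 2) ≤ N * G x x := by
    intro x
    rcases (Finset.sum_nonneg fun j _ ↦ sq_nonneg (x j) : 0 ≤ ∑ j, x j ^ 2).eq_or_lt with h | h
    · have hx : x = (0 : ℝ) • x := by
        ext j
        have := (Finset.sum_eq_zero_iff_of_nonneg fun j _ ↦ sq_nonneg (x j)).1 h.symm j
          (Finset.mem_univ j)
        simpa using this
      rw [← h, hx, hsmul]; simp
    · set q := ∑ j, x j ^ 2
      set s := √(N / q)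
      have hs : s ^ 2 = N / q := Real.sq_sqrt (by positivity)
      have hsq : ∑ j, (s • x) j ^ 2 ≤ N := by
        simp only [Pi.smul_apply, smul_eq_mul, mul_pow, ← Finset.mul_sum, hs]
        change N / q * q ≤ N
        rw [div_mul_cancel₀ _ h.ne']
      have h1 := hC (s • x) ((-s) • x) hsq (by simpa using hsq)
      rw [hsmul, hsymm, hsmul] at h1
      have h2 : -(N / q * G x x) ≤ C := by rw [← hs]; linarith
      have h3 := mul_le_mul_of_nonneg_right h2 h.le
      have h4 : N / q * G x x * q = N * G x x := by field_simp
      linarith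
  have hneg : ∀ x y, G x (-y) = -G x y := fun x y ↦ by simpa using hsmul (-1) x y
  have h1 := hlow (u - v)
  have hpar : ∑ j, (u + v) j ^ 2 + ∑ j, (u - v) j ^ 2 =
      2 * ∑ j, u j ^ 2 + 2 * ∑ j, v j ^ 2 := by
    simp only [Finset.mul_sum, ← Finset.sum_add_distrib, Pi.add_apply, Pi.sub_apply]
    exact Finset.sum_congr rfl fun _ _ ↦ by ring
  have h2 : G (u + v) (u + v) = G u u + 2 * G u v + G v v := by
    rw [hadd, hsymm (u + v), hsymm (u + v), hadd, hadd, hsymm v u]; ring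
  have h3 : G (u - v) (u - v) = G u u - 2 * G u v + G v v := by
    rw [sub_eq_add_neg, hadd, hneg, hsymm (u + -v), hsymm (u + -v), hadd, hadd, hneg, hneg,
      hsymm v u]; ring
  have h4 : C * (∑ j, (u + v) j ^ 2 + ∑ j, (u - v) j ^ 2) ≤ C * (4 * N) :=
    mul_le_mul_of_nonneg_left (by linarith) hC0
  have h5 := mul_le_mul_of_nonneg_left huv hN.le
  rw [h3] at h1
  rw [h2]
  linarith

/-- A Hadamard-type inequality for permanents (Carlen, Lieb and Loss). -/
theorem Matrix.permanent_le_factorial {ι : Type*} [Fintype ι] [DecidableEq ι]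
    (M : Matrix ι ι ℝ) (hM : ∀ i, ∑ j, M i j ^ 2 ≤ Fintype.card ι) :
    M.permanent ≤ (Fintype.card ι).factorial := by
  rcases isEmpty_or_nonempty ι with _ | hne
  · simp [permanent_isEmpty]
  have hN : (0 : ℝ) < Fintype.card ι := by exact_mod_cast Fintype.card_pos
  set N : ℝ := (Fintype.card ι : ℝ) with hNdef
  let K : Set (Matrix ι ι ℝ) := {M | ∀ i, ∑ j, M i j ^ 2 ≤ N}
  have hKc : IsCompact K := by
    have hcl : IsClosed K := by
      simp only [K, Set.ofPred_forall]
      exact isClosed_iInter fun i ↦ isClosed_le (by fun_prop) continuous_const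
    have hbox : IsCompact (Set.univ.pi fun _ : ι ↦ Set.univ.pi fun _ : ι ↦
        Set.Icc (-(N + 1)) (N + 1)) :=
      isCompact_univ_pi fun _ ↦ isCompact_univ_pi fun _ ↦ isCompact_Icc
    refine hbox.of_isClosed_subset hcl ?_
    intro M hM i _ j _
    have : M i j ^ 2 ≤ N :=
      (Finset.single_le_sum (f := fun j ↦ M i j ^ 2) (fun _ _ ↦ sq_nonneg _)
        (Finset.mem_univ j)).trans (hM i)
    exact ⟨by nlinarith, by nlinarith⟩
  obtain ⟨M₀, hM₀, hmax⟩ := hKc.exists_isMaxOn ⟨M, hM⟩ continuous_permanent.continuousOn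
  set C := M₀.permanent with hCdef
  have hC : ∀ P ∈ K, P.permanent ≤ C := fun P hP ↦ hmax hP
  have hCpos : 0 < C := by
    have h1 : (of fun _ : ι ↦ fun _ : ι ↦ (1 : ℝ)) ∈ K := fun i ↦ by simp [hNdef]
    have := hC _ h1
    rw [permanent_of_const_rows] at this
    refine lt_of_lt_of_le ?_ this
    simp [Nat.factorial_pos]
  let K' : Set (Matrix ι ι ℝ) := K ∩ {P | (∀ i j, 0 ≤ P i j) ∧ C ≤ P.permanent}
  have hK'c : IsCompact K' := by
    refine hKc.inter_right (IsClosed.inter (s₁ := {P : Matrix ι ι ℝ | ∀ i j, 0 ≤ P i j}) ?_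
      (isClosed_le continuous_const continuous_permanent))
    simp only [Set.ofPred_forall]
    exact isClosed_iInter fun i ↦ isClosed_iInter fun j ↦ isClosed_le continuous_const (by fun_prop)
  have hK'ne : K'.Nonempty :=
    ⟨of fun i j ↦ |M₀ i j|, fun i ↦ by simpa using hM₀ i, fun i j ↦ by simp,
      permanent_le_permanent_abs M₀⟩
  obtain ⟨P, ⟨hPK, hP0, hPC⟩, hPmax⟩ := hK'c.exists_isMaxOn hK'ne
    (f := fun P ↦ ∑ i, ∑ j, P i j) (by fun_prop)
  have hrows : ∀ a b, P a = P b := by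
    intro a b
    by_contra hne
    have hab : a ≠ b := fun h ↦ hne (h ▸ rfl)
    set u := P a with hu
    set v := P b with hv
    let Q := fun x y ↦ (P.updateRow a x).updateRow b y
    have hQ : ∀ x y i, Q x y i = if i = b then y else if i = a then x else P i := by
      intro x y i; ext j; simp only [Q, updateRow_apply]; split_ifs <;> rfl
    have hQK : ∀ x y, ∑ j, x j ^ 2 ≤ N → ∑ j, y j ^ 2 ≤ N → Q x y ∈ K := by
      intro x y hx hy i
      rw [hQ]; split_ifs
      exacts [hy, hx, hPK i]
    have hQuv : Q u v = P := by
      funext i; rw [hQ]; split_ifs with h h'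
      exacts [h ▸ rfl, h' ▸ rfl, rfl]
    have hsymm : ∀ x y, (Q x y).permanent = (Q y x).permanent :=
      fun x y ↦ permanent_updateRow_updateRow_comm P hab x y
    have hsmul : ∀ (c : ℝ) x y, (Q x (c • y)).permanent = c * (Q x y).permanent :=
      fun c x y ↦ permanent_updateRow_smul _ _ _ _
    have key := le_bilin_add_of_isMax (G := fun x y ↦ (Q x y).permanent) hsymm
      (fun x y z ↦ permanent_updateRow_add _ _ _ _) hsmul hN
      (fun x y hx hy ↦ hC _ (hQK x y hx hy)) (hPK a) (hPK b) hCpos.le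
      (show C ≤ (Q u v).permanent by rwa [hQuv])
    change C * ∑ j, (u + v) j ^ 2 ≤ N * (Q (u + v) (u + v)).permanent at key
    obtain ⟨j₀, hj₀⟩ := Function.ne_iff.1 hne
    have hw0 : ∀ j, 0 ≤ (u + v) j := fun j ↦ add_nonneg (hP0 a j) (hP0 b j)
    have hwj : 0 < (u + v) j₀ := by
      refine (hw0 j₀).lt_of_ne fun h ↦ hj₀ ?_
      have h1 := hP0 a j₀
      have h2 := hP0 b j₀
      simp only [Pi.add_apply] at h
      change 0 ≤ u j₀ at h1
      change 0 ≤ v j₀ at h2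
      linarith
    have hpar : ∑ j, (u + v) j ^ 2 + ∑ j, (u - v) j ^ 2 =
        2 * ∑ j, u j ^ 2 + 2 * ∑ j, v j ^ 2 := by
      simp only [Finset.mul_sum, ← Finset.sum_add_distrib, Pi.add_apply, Pi.sub_apply]
      exact Finset.sum_congr rfl fun _ _ ↦ by ring
    have hr : 0 < ∑ j, (u - v) j ^ 2 := Finset.sum_pos' (fun _ _ ↦ sq_nonneg _)
      ⟨j₀, Finset.mem_univ _, by
        have := sub_ne_zero.2 hj₀
        simp only [Pi.sub_apply]; positivity⟩
    have hq : 0 < ∑ j, (u + v) j ^ 2 := Finset.sum_pos' (fun _ _ ↦ sq_nonneg _)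
      ⟨j₀, Finset.mem_univ _, by positivity⟩
    have hs1 : 0 < ∑ j, (u + v) j := Finset.sum_pos' (fun j _ ↦ hw0 j)
      ⟨j₀, Finset.mem_univ _, hwj⟩
    have hPa := hPK a
    have hPb := hPK b
    set q := ∑ j, (u + v) j ^ 2
    have hq4 : q < 4 * N := by linarith
    set s := √(N / q)
    have hs : s ^ 2 = N / q := Real.sq_sqrt (by positivity)
    have hs0 : 0 ≤ s := Real.sqrt_nonneg _
    have hs2 : 1 / 2 < s := by
      have : 1 / 4 < N / q := by rw [div_lt_div_iff₀ (by norm_num) hq]; linarith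
      nlinarith
    have hsq : ∑ j, (s • (u + v)) j ^ 2 ≤ N := by
      simp only [Pi.smul_apply, smul_eq_mul, mul_pow, ← Finset.mul_sum, hs]
      change N / q * q ≤ N
      rw [div_mul_cancel₀ _ hq.ne']
    have hQ' : Q (s • (u + v)) (s • (u + v)) ∈ K' := by
      refine ⟨hQK _ _ hsq hsq, fun i j ↦ ?_, ?_⟩
      · rw [hQ]; split_ifs
        exacts [mul_nonneg hs0 (hw0 j), mul_nonneg hs0 (hw0 j), hP0 i j]
      · rw [hsmul, hsymm, hsmul, ← mul_assoc, ← sq, hs, div_mul_eq_mul_div, le_div_iff₀ hq]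
        exact key
    have hle := hPmax hQ'
    simp only [Set.mem_ofPred_eq] at hle
    rw [← sub_nonpos, ← Finset.sum_sub_distrib, Fintype.sum_eq_add a b hab] at hle
    · rw [hQ, hQ, if_neg hab, if_pos rfl, if_pos rfl] at hle
      simp only [Pi.smul_apply, smul_eq_mul, ← Finset.mul_sum] at hle
      have : ∑ j, (u + v) j = ∑ j, P a j + ∑ j, P b j := Finset.sum_add_distrib
      nlinarith
    · rintro i ⟨hia, hib⟩
      rw [hQ, if_neg hib, if_neg hia, sub_self]
  obtain ⟨a⟩ := hne
  have hP : P = of fun _ ↦ P a := funext fun i ↦ hrows i a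
  calc M.permanent ≤ C := hC M hM
    _ ≤ P.permanent := hPC
    _ = (Fintype.card ι).factorial * ∏ j, P a j := by
        rw [hP, permanent_of_const_rows]; rfl
    _ ≤ (Fintype.card ι).factorial := mul_le_of_le_one_right (by positivity)
        (prod_le_one_of_sum_sq_le_card (hPK a))

section lpNorm

variable {ι : Type*} [Fintype ι] {p : ℝ≥0∞}

theorem lpNorm_eq_norm_toLp [Fact (1 ≤ p)] (x : ι → ℝ) : lpNorm p x = ‖WithLp.toLp p x‖ := by
  unfold lpNorm
  split_ifs with h
  · subst h; simp [PiLp.norm_eq_ciSup]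
  · rw [PiLp.norm_eq_sum (ENNReal.toReal_pos (zero_lt_one.trans_le Fact.out).ne' h)]
    simp

theorem lpNorm_smul [Fact (1 ≤ p)] (c : ℝ) (x : ι → ℝ) : lpNorm p (c • x) = |c| * lpNorm p x := by
  simp [lpNorm_eq_norm_toLp, norm_smul]

theorem lpNorm_nonneg [Fact (1 ≤ p)] (x : ι → ℝ) : 0 ≤ lpNorm p x := by
  simp [lpNorm_eq_norm_toLp]

theorem abs_apply_le_lpNorm [Fact (1 ≤ p)] (x : ι → ℝ) (i : ι) : |x i| ≤ lpNorm p x := by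
  rw [lpNorm_eq_norm_toLp]
  exact PiLp.norm_apply_le (WithLp.toLp p x) i

theorem lpNorm_rpow_toReal (hp0 : p ≠ 0) (hp : p ≠ ∞) (x : ι → ℝ) :
    lpNorm p x ^ p.toReal = ∑ i, |x i| ^ p.toReal := by
  have := ENNReal.toReal_pos hp0 hp
  rw [lpNorm, if_neg hp, ← Real.rpow_mul (by positivity), one_div_mul_cancel this.ne',
    Real.rpow_one]

theorem sum_sq_le_card_of_sum_rpow_le_card {q : ℝ} (hq : 2 ≤ q) {a : ι → ℝ} (ha : ∀ i, 0 ≤ a i)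
    (h : ∑ i, a i ^ q ≤ Fintype.card ι) : ∑ i, a i ^ 2 ≤ Fintype.card ι := by
  rcases isEmpty_or_nonempty ι with _ | _
  · simp
  have hN : (0 : ℝ) < Fintype.card ι := by exact_mod_cast Fintype.card_pos
  have key := Real.rpow_sum_le_const_mul_sum_rpow_of_nonneg Finset.univ (f := fun i ↦ a i ^ 2)
    (p := q / 2) (by linarith) (fun i _ ↦ sq_nonneg _)
  have hpow : ∀ i, (a i ^ 2) ^ (q / 2) = a i ^ q := fun i ↦ by
    rw [← Real.rpow_natCast, ← Real.rpow_mul (ha i)]; congr 1; push_cast; ring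
  simp only [hpow, Finset.card_univ] at key
  refine (Real.rpow_le_rpow_iff (Finset.sum_nonneg fun _ _ ↦ sq_nonneg _) hN.le
    (show 0 < q / 2 by linarith)).1 (key.trans ?_)
  calc _ ≤ (Fintype.card ι : ℝ) ^ (q / 2 - 1) * Fintype.card ι := by gcongr
    _ = _ := by rw [Real.rpow_sub_one hN.ne', div_mul_cancel₀ _ hN.ne']

end lpNorm

section symTensor

variable {d : ℕ} {n : Fin d → ℕ} {p : ℝ≥0∞}

theorem sum_symTensor_mul_prod (A : ((j : Fin d) → Fin (n j)) → ℝ)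
    (z : Fin d → (Σ j : Fin d, Fin (n j)) → ℝ) :
    ∑ k, symTensor A k * ∏ s, z s (k s) =
      ∑ σ : Equiv.Perm (Fin d), ∑ i : (j : Fin d) → Fin (n j), A i * ∏ t, z (σ t) ⟨t, i t⟩ := by
  simp only [symTensor, Finset.sum_mul]
  rw [Finset.sum_comm]
  refine Finset.sum_congr rfl fun σ _ ↦ (Fintype.sum_of_injective
    (fun (i : (j : Fin d) → Fin (n j)) (s : Fin d) ↦
      (⟨σ.symm s, i (σ.symm s)⟩ : Σ j : Fin d, Fin (n j))) ?_ _ _ ?_ ?_).symm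
  · intro i i' h
    funext t
    have h' : (⟨σ.symm (σ t), i (σ.symm (σ t))⟩ : Σ j : Fin d, Fin (n j)) =
      ⟨σ.symm (σ t), i' (σ.symm (σ t))⟩ := congrFun h (σ t)
    rw [σ.symm_apply_apply] at h'
    exact eq_of_heq (Sigma.mk.inj h').2
  · intro k hk
    rw [dif_neg, zero_mul]
    intro h
    refine hk ⟨fun t ↦ Fin.cast (congrArg n (h t)) (k (σ t)).2, funext fun s ↦ ?_⟩
    have key : ∀ (t : Fin d) (m : Σ j : Fin d, Fin (n j)) (hm : m.1 = t),
        (⟨t, Fin.cast (congrArg n hm) m.2⟩ : Σ j : Fin d, Fin (n j)) = m := by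
      rintro _ m rfl; rfl
    exact (key _ _ (h (σ.symm s))).trans (congrArg k (σ.apply_symm_apply s))
  · intro i
    have h : ∀ t, σ.symm (σ t) = t := σ.symm_apply_apply
    rw [dif_pos h]
    congr 1
    · have key : ∀ (s t : Fin d) (hst : s = t), i t = Fin.cast (congrArg n hst) (i s) := by
        rintro s _ rfl; rfl
      exact congrArg A (funext fun t ↦ key _ _ (h t))
    · rw [← Equiv.prod_comp σ fun s ↦ z s ⟨σ.symm s, i (σ.symm s)⟩]
      exact Finset.prod_congr rfl fun t _ ↦ congrArg (z (σ t))
        (congrArg (fun s ↦ (⟨s, i s⟩ : Σ j : Fin d, Fin (n j))) (h t)).symm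

theorem sum_symTensor_mul_prod_diag (A : ((j : Fin d) → Fin (n j)) → ℝ)
    (z : (Σ j : Fin d, Fin (n j)) → ℝ) :
    ∑ k, symTensor A k * ∏ s, z (k s) =
      d.factorial * ∑ i : (j : Fin d) → Fin (n j), A i * ∏ t, z ⟨t, i t⟩ := by
  rw [sum_symTensor_mul_prod A fun _ ↦ z]
  simp [Fintype.card_perm]

theorem multilinear_smul (A : ((j : Fin d) → Fin (n j)) → ℝ) (c : Fin d → ℝ)
    (x : (j : Fin d) → Fin (n j) → ℝ) :
    ∑ i : (j : Fin d) → Fin (n j), A i * ∏ j, (c j • x j) (i j) =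
      (∏ j, c j) * ∑ i : (j : Fin d) → Fin (n j), A i * ∏ j, x j (i j) := by
  simp only [Pi.smul_apply, smul_eq_mul, Finset.prod_mul_distrib, Finset.mul_sum]
  exact Finset.sum_congr rfl fun _ _ ↦ by ring

theorem multilinear_le_mul_prod_lpNorm [Fact (1 ≤ p)] (A : ((j : Fin d) → Fin (n j)) → ℝ) {S : ℝ}
    (hS : ∀ x : (j : Fin d) → Fin (n j) → ℝ, (∀ j, lpNorm p (x j) ≤ 1) →
      ∑ i : (j : Fin d) → Fin (n j), A i * ∏ j, x j (i j) ≤ S)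
    (x : (j : Fin d) → Fin (n j) → ℝ) :
    ∑ i : (j : Fin d) → Fin (n j), A i * ∏ j, x j (i j) ≤ S * ∏ j, lpNorm p (x j) := by
  by_cases h : ∃ j, lpNorm p (x j) = 0
  · obtain ⟨j, hj⟩ := h
    rw [Finset.prod_eq_zero (Finset.mem_univ j) hj, mul_zero]
    refine (Finset.sum_eq_zero fun i _ ↦ ?_).le
    rw [Finset.prod_eq_zero (Finset.mem_univ j), mul_zero]
    exact abs_nonpos_iff.1 ((abs_apply_le_lpNorm (x j) (i j)).trans hj.le)
  · push Not at h
    have hpos : ∀ j, 0 < lpNorm p (x j) := fun j ↦ (lpNorm_nonneg _).lt_of_ne (h j).symm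
    have h1 := hS (fun j ↦ (lpNorm p (x j))⁻¹ • x j) fun j ↦ by
      rw [lpNorm_smul, abs_of_pos (inv_pos.2 (hpos j)), inv_mul_cancel₀ (h j)]
    rwa [multilinear_smul, Finset.prod_inv_distrib,
      inv_mul_le_iff₀ (Finset.prod_pos fun j _ ↦ hpos j), mul_comm _ S] at h1

theorem sum_sq_lpNorm_block_le (hp : 2 ≤ p) {z : (Σ j : Fin d, Fin (n j)) → ℝ}
    (hz : lpNorm p z ≤ if p = ∞ then 1 else (d : ℝ) ^ (1 / p.toReal)) :
    ∑ t, lpNorm p (fun i ↦ z ⟨t, i⟩) ^ 2 ≤ d := by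
  have : Fact (1 ≤ p) := ⟨one_le_two.trans hp⟩
  have hp0 : p ≠ 0 := (zero_lt_two.trans_le hp).ne'
  split_ifs at hz with h
  · have hle : ∀ t, lpNorm p (fun i ↦ z ⟨t, i⟩) ^ 2 ≤ 1 := by
      intro t
      refine pow_le_one₀ (lpNorm_nonneg _) ?_
      rw [lpNorm, if_pos h]
      exact Real.iSup_le (fun i ↦ (abs_apply_le_lpNorm z _).trans hz) zero_le_one
    simpa using Finset.sum_le_sum fun t (_ : t ∈ Finset.univ) ↦ hle t
  · have hq : 2 ≤ p.toReal := by simpa using ENNReal.toReal_mono h hp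
    have := sum_sq_le_card_of_sum_rpow_le_card hq
      (a := fun t ↦ lpNorm p (fun i ↦ z ⟨t, i⟩)) (fun _ ↦ lpNorm_nonneg _) ?_
    · simpa using this
    · simp only [lpNorm_rpow_toReal hp0 h]
      rw [← Fintype.sum_sigma' (fun t i ↦ |z ⟨t, i⟩| ^ p.toReal), ← lpNorm_rpow_toReal hp0 h]
      refine (Real.rpow_le_rpow (lpNorm_nonneg _) hz (by linarith)).trans ?_
      rw [← Real.rpow_mul (by positivity), one_div_mul_cancel (by linarith), Real.rpow_one,
        Fintype.card_fin]

theorem lpNorm_sigma_le (hp0 : p ≠ 0) [Fact (1 ≤ p)] {x : (j : Fin d) → Fin (n j) → ℝ}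
    (hx : ∀ j, lpNorm p (x j) ≤ 1) :
    lpNorm p (fun k : Σ j : Fin d, Fin (n j) ↦ x k.1 k.2) ≤
      if p = ∞ then 1 else (d : ℝ) ^ (1 / p.toReal) := by
  split_ifs with h
  · rw [lpNorm, if_pos h]
    exact Real.iSup_le (fun k ↦ (abs_apply_le_lpNorm (x k.1) k.2).trans (hx k.1)) zero_le_one
  · rw [lpNorm, if_neg h]
    refine Real.rpow_le_rpow (by positivity) ?_ (by positivity)
    rw [Fintype.sum_sigma]
    simp only [← lpNorm_rpow_toReal hp0 h]
    simpa using Finset.sum_le_sum fun j (_ : j ∈ Finset.univ) ↦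
      Real.rpow_le_one (lpNorm_nonneg _) (hx j) (ENNReal.toReal_nonneg (a := p))

theorem sum_symTensor_mul_prod_le (hp : 2 ≤ p) (A : ((j : Fin d) → Fin (n j)) → ℝ) {S : ℝ}
    (hS0 : 0 ≤ S)
    (hS : ∀ x : (j : Fin d) → Fin (n j) → ℝ, (∀ j, lpNorm p (x j) ≤ 1) →
      ∑ i : (j : Fin d) → Fin (n j), A i * ∏ j, x j (i j) ≤ S)
    {z : Fin d → (Σ j : Fin d, Fin (n j)) → ℝ}
    (hz : ∀ i, lpNorm p (z i) ≤ if p = ∞ then 1 else (d : ℝ) ^ (1 / p.toReal)) :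
    ∑ k, symTensor A k * ∏ s, z s (k s) ≤ d.factorial * S := by
  have : Fact (1 ≤ p) := ⟨one_le_two.trans hp⟩
  have hperm := Matrix.permanent_le_factorial
    (Matrix.of fun s t ↦ lpNorm p (fun i : Fin (n t) ↦ z s ⟨t, i⟩))
    (fun s ↦ by simpa using sum_sq_lpNorm_block_le hp (hz s))
  rw [Fintype.card_fin] at hperm
  calc _ ≤ S * Matrix.permanent (Matrix.of fun s t ↦ lpNorm p (fun i : Fin (n t) ↦ z s ⟨t, i⟩)) := by
        rw [sum_symTensor_mul_prod, Matrix.permanent, Finset.mul_sum]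
        exact Finset.sum_le_sum fun σ _ ↦
          multilinear_le_mul_prod_lpNorm A hS fun t i ↦ z (σ t) ⟨t, i⟩
    _ ≤ _ := by rw [mul_comm]; gcongr

theorem multilinear_le_sum_abs [Fact (1 ≤ p)] (A : ((j : Fin d) → Fin (n j)) → ℝ)
    {x : (j : Fin d) → Fin (n j) → ℝ} (hx : ∀ j, lpNorm p (x j) ≤ 1) :
    ∑ i : (j : Fin d) → Fin (n j), A i * ∏ j, x j (i j) ≤ ∑ i, |A i| := by
  refine Finset.sum_le_sum fun i _ ↦ (le_abs_self _).trans ?_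
  rw [abs_mul, Finset.abs_prod]
  exact mul_le_of_le_one_right (abs_nonneg _) (Finset.prod_le_one (fun _ _ ↦ abs_nonneg _)
    fun j _ ↦ (abs_apply_le_lpNorm (x j) (i j)).trans (hx j))

end symTensor

/-- `sup{ F_{sym(A)}(z^1,…,z^d) : ‖z^i‖_p ≤ d^{1/p} ∀ i } = d! · sup{ F_A(x^1,…,x^d) :
‖x^i‖_p ≤ 1 ∀ i }` for any order-`d` tensor `A` and `p ∈ [2,∞]` (`d^{1/p} = 1` at `p = ∞`). -/
theorem sup_sym_multilinear_eq_factorial_mul_sup (d : ℕ) (hd : 2 ≤ d)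
    (p : ℝ≥0∞) (hp : 2 ≤ p) (n : Fin d → ℕ)
    (A : ((j : Fin d) → Fin (n j)) → ℝ) :
    sSup {v : ℝ | ∃ z : Fin d → ((Σ j : Fin d, Fin (n j)) → ℝ),
        (∀ i, lpNorm p (z i) ≤ (if p = ∞ then 1 else (d : ℝ) ^ (1 / p.toReal))) ∧
        (∑ k : Fin d → (Σ j : Fin d, Fin (n j)), symTensor A k * ∏ s, z s (k s)) = v}
      = (Nat.factorial d : ℝ) *
        sSup {v : ℝ | ∃ x : (j : Fin d) → (Fin (n j) → ℝ),
          (∀ j, lpNorm p (x j) ≤ 1) ∧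
          (∑ i : (j : Fin d) → Fin (n j), A i * ∏ j, x j (i j)) = v} := by
  have : Fact (1 ≤ p) := ⟨one_le_two.trans hp⟩
  have hp0 : p ≠ 0 := (zero_lt_two.trans_le hp).ne'
  have hfac : (0 : ℝ) < d.factorial := by exact_mod_cast d.factorial_pos
  have hd0 : d ≠ 0 := by omega
  set R := {v : ℝ | ∃ x : (j : Fin d) → (Fin (n j) → ℝ),
    (∀ j, lpNorm p (x j) ≤ 1) ∧
    (∑ i : (j : Fin d) → Fin (n j), A i * ∏ j, x j (i j)) = v}
  have hRbdd : BddAbove R := ⟨∑ i, |A i|, by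
    rintro _ ⟨x, hx, rfl⟩; exact multilinear_le_sum_abs A hx⟩
  have hR0 : (0 : ℝ) ∈ R := ⟨0, fun j ↦ by simp [lpNorm_eq_norm_toLp], by simp [hd0]⟩
  have hup : ∀ z : Fin d → ((Σ j : Fin d, Fin (n j)) → ℝ),
      (∀ i, lpNorm p (z i) ≤ (if p = ∞ then 1 else (d : ℝ) ^ (1 / p.toReal))) →
      ∑ k, symTensor A k * ∏ s, z s (k s) ≤ d.factorial * sSup R := fun z hz ↦
    sum_symTensor_mul_prod_le hp A (le_csSup hRbdd hR0)
      (fun x hx ↦ le_csSup hRbdd ⟨x, hx, rfl⟩) hz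
  apply le_antisymm
  · refine csSup_le ⟨0, 0, fun i ↦ ?_, by simp [hd0]⟩ ?_
    · simp only [lpNorm_eq_norm_toLp, Pi.zero_apply, WithLp.toLp_zero, norm_zero]
      split_ifs <;> positivity
    · rintro _ ⟨z, hz, rfl⟩
      exact hup z hz
  · rw [← le_div_iff₀' hfac]
    refine csSup_le ⟨0, hR0⟩ ?_
    rintro _ ⟨x, hx, rfl⟩
    rw [le_div_iff₀' hfac]
    refine le_csSup ⟨d.factorial * sSup R, ?_⟩ ⟨fun _ k ↦ x k.1 k.2, fun _ ↦ lpNorm_sigma_le hp0 hx,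
      sum_symTensor_mul_prod_diag A fun k ↦ x k.1 k.2⟩
    rintro _ ⟨z, hz, rfl⟩
    exact hup z hz
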